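/- arXiv:1504.02899 — 3 statements merged into one kernel-verified Lean document; each statement's English description precedes it below -/
import Mathlib

section
/- Let A be an idempotent ternary semigroup, B a ternary subsemigroup of A with B ⊴ A. Then there exists a positive integer l such that for every a ∈ A and b ∈ B, both b(ab)^l ∈ B and b(ab)^{l+1} ∈ B. -/
/-- The product of the word `a :: l` in a ternary semigroup, grouping from the left
(well-behaved when `l` has even length, i.e. the word `a :: l` has odd length). -/
def terProd {A : Type*} (f : A → A → A → A) : A → List A → A
  | a, [] => a
  | a, [_] => a
  | a, x :: y :: l => terProd f (f a x y) l

/-- Ternary associativity. -/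
def TAssoc {A : Type*} (f : A → A → A → A) : Prop :=
  ∀ a₁ a₂ a₃ a₄ a₅ : A,
    f (f a₁ a₂ a₃) a₄ a₅ = f a₁ (f a₂ a₃ a₄) a₅ ∧
    f a₁ (f a₂ a₃ a₄) a₅ = f a₁ a₂ (f a₃ a₄ a₅)

/-- `B` absorbs the ternary semigroup `(A, f)`: there is an idempotent term (a word
`hd :: tl` of odd length in `m` variables) such that substituting an arbitrary element
at any single coordinate and elements of `B` at all other coordinates yields a value
in `B`. -/
def TAbsorbs {A : Type*} (f : A → A → A → A) (B : Set A) : Prop :=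
  ∃ (m : ℕ) (hd : Fin m) (tl : List (Fin m)), Even tl.length ∧
    (∀ a : A, terProd f a (tl.map fun _ => a) = a) ∧
    ∀ (a : A) (b : Fin m → A), (∀ i, b i ∈ B) → ∀ j : Fin m,
      terProd f (Function.update b j a hd) (tl.map (Function.update b j a)) ∈ B

section abs
variable {M : Type*} [Monoid M] (σ : M →* M)

/-- alternating product -/
def ap : List M → M
  | [] => 1
  | x :: l => x * σ (ap l)

/-- signed count of occurrences of `j` -/
def sct {m : ℕ} (j : Fin m) : List (Fin m) → ℤ
  | [] => 0
  | i :: l => (if i = j then 1 else 0) - sct j l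

inductive QQ (u v : M) : M → ℤ → Prop
  | one : QQ u v 1 0
  | consu (w c) : QQ u v w c → QQ u v (u * w) (c + 1)
  | consv (w c) : QQ u v w c → QQ u v (v * w) (c - 1)

theorem QQ.mul {u v w w' : M} {c c' : ℤ} (h : QQ u v w c) (h' : QQ u v w' c') :
    QQ u v (w * w') (c + c') := by
  induction h with
  | one => simpa using h'
  | consu w c _ ih =>
    rw [mul_assoc, show c + 1 + c' = (c + c') + 1 by ring]; exact QQ.consu _ _ ih
  | consv w c _ ih =>
    rw [mul_assoc, show c - 1 + c' = (c + c') - 1 by ring]; exact QQ.consv _ _ ih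

theorem QQ.bar (hσ : ∀ y, σ (σ y) = y) {u w : M} {c : ℤ} (h : QQ u (σ u) w c) :
    QQ u (σ u) (σ w) (-c) := by
  induction h with
  | one => simpa using QQ.one
  | consu w c _ ih =>
    rw [map_mul, show -(c + 1) = -c - 1 by ring]; exact QQ.consv _ _ ih
  | consv w c _ ih =>
    rw [map_mul, hσ, show -(c - 1) = -c + 1 by ring]; exact QQ.consu _ _ ih

/-- integer powers relative to an identity `I` and inverse `r` -/
def zz (I u r : M) : ℤ → M
  | Int.ofNat n => I * u ^ n
  | Int.negSucc n => r ^ (n + 1)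

theorem zz_succ {I u r : M} (hIu : I * u = u) (huI : u * I = u) (hII : I * I = I)
    (hur : u * r = I) (hIr : I * r = r) (c : ℤ) : u * zz I u r c = zz I u r (c + 1) := by
  rcases c with n | n
  · change u * (I * u ^ n) = I * u ^ (n + 1)
    rw [← mul_assoc, huI, pow_succ', ← mul_assoc, hIu]
  · rcases n with _ | n
    · change u * r ^ (0 + 1) = I * u ^ 0
      simp [hur]
    · change u * r ^ (n + 1 + 1) = r ^ (n + 1)
      rw [pow_succ', ← mul_assoc, hur, pow_succ', ← mul_assoc, hIr]

theorem zz_pred {I u r : M} (hIu : I * u = u) (hrI : r * I = r)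
    (hru : r * u = I) (c : ℤ) : r * zz I u r c = zz I u r (c - 1) := by
  rcases c with n | n
  · rcases n with _ | n
    · change r * (I * u ^ 0) = r ^ (0 + 1)
      simp [hrI]
    · rw [show (Int.ofNat (n + 1) - 1) = Int.ofNat n by simp]
      change r * (I * u ^ (n + 1)) = I * u ^ n
      rw [← mul_assoc, hrI, pow_succ', ← mul_assoc, hru]
  · change r * r ^ (n + 1) = r ^ (n + 1 + 1)
    rw [pow_succ' r (n + 1)]

theorem class_start {m : ℕ} (hσ : ∀ y, σ (σ y) = y) (e : M)
    (j : Fin m) (l : List (Fin m)) :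
    (sct j l = 0 ∧ ∀ s, ap σ (l.map (Function.update (fun _ => (1 : M)) j s)) = 1) ∨
    (∀ s, e * s = s → e * ap σ (l.map (Function.update (fun _ => (1 : M)) j s))
      = ap σ (l.map (Function.update (fun _ => (1 : M)) j s))) ∨
    (∀ s, e * s = s → σ e * ap σ (l.map (Function.update (fun _ => (1 : M)) j s))
      = ap σ (l.map (Function.update (fun _ => (1 : M)) j s))) := by
  induction l with
  | nil => left; simp [sct, ap]
  | cons i l ih =>
    by_cases hij : i = j
    · subst hij
      right; left
      intro s hs
      simp only [List.map_cons, ap, Function.update_self]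
      rw [← mul_assoc, hs]
    · simp only [List.map_cons, ap, Function.update_of_ne hij, one_mul, sct, if_neg hij]
      rcases ih with ⟨h0, h⟩ | h | h
      · left
        refine ⟨by simp [h0], fun s => by simp [h s]⟩
      · right; right
        intro s hs
        rw [← map_mul, h s hs]
      · right; left
        intro s hs
        have := congrArg σ (h s hs)
        rwa [map_mul, hσ] at this

theorem class_end {m : ℕ} (hσ : ∀ y, σ (σ y) = y) (e : M)
    (j : Fin m) (l : List (Fin m)) :
    (sct j l = 0 ∧ ∀ s, ap σ (l.map (Function.update (fun _ => (1 : M)) j s)) = 1) ∨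
    (∀ s, s * e = s → ap σ (l.map (Function.update (fun _ => (1 : M)) j s)) * e
      = ap σ (l.map (Function.update (fun _ => (1 : M)) j s))) ∨
    (∀ s, s * e = s → ap σ (l.map (Function.update (fun _ => (1 : M)) j s)) * σ e
      = ap σ (l.map (Function.update (fun _ => (1 : M)) j s))) := by
  induction l with
  | nil => left; simp [sct, ap]
  | cons i l ih =>
    rcases ih with ⟨h0, h⟩ | h | h
    · by_cases hij : i = j
      · subst hij
        right; left
        intro s hs
        simp [ap, h s, hs]
      · left
        refine ⟨by simp [sct, h0, hij], fun s => by simp [ap, h s, hij]⟩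
    · right; right
      intro s hs
      simp only [List.map_cons, ap]
      rw [mul_assoc, ← map_mul, h s hs]
    · right; left
      intro s hs
      have := congrArg σ (h s hs)
      rw [map_mul, hσ] at this
      simp only [List.map_cons, ap]
      rw [mul_assoc, this]

theorem ap_QQ {m : ℕ} (hσ : ∀ y, σ (σ y) = y) {u s : M} {d : ℤ} (hs : QQ u (σ u) s d)
    (j : Fin m) (l : List (Fin m)) :
    QQ u (σ u) (ap σ (l.map (Function.update (fun _ => (1 : M)) j s))) (d * sct j l) := by
  induction l with
  | nil => simpa [ap, sct] using QQ.one
  | cons i l ih =>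
    have h := ih.bar σ hσ
    by_cases hij : i = j
    · subst hij
      simp only [List.map_cons, ap, Function.update_self, sct, if_true]
      have := hs.mul h
      rwa [show d * (1 - sct i l) = d + -(d * sct i l) by ring]
    · simp only [List.map_cons, ap, Function.update_of_ne hij, sct, if_neg hij, one_mul]
      rwa [show d * (0 - sct j l) = -(d * sct j l) by ring]

theorem key {m : ℕ} (hσ : ∀ y, σ (σ y) = y) (hreg : ∀ y, y * σ y * y = y)
    (W : Submonoid M) (hW : ∀ y ∈ W, σ y ∈ W) (j : Fin m) (l : List (Fin m))
    (hl : ∀ s, ap σ (l.map (Function.update (fun _ => (1 : M)) j s)) ∈ W) (u : M) :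
    u ^ (sct j l).natAbs ∈ W := by
  by_cases hc0 : sct j l = 0
  · simp [hc0, W.one_mem]
  obtain ⟨v, hv⟩ : ∃ v, σ u = v := ⟨_, rfl⟩
  have hvu : σ v = u := by rw [← hv, hσ]
  obtain ⟨e, he⟩ : ∃ e, u * v = e := ⟨_, rfl⟩
  obtain ⟨g, hg⟩ : ∃ g, v * u = g := ⟨_, rfl⟩
  have hσe : σ e = g := by rw [← he, map_mul, hv, hvu, hg]
  have hσg : σ g = e := by rw [← hσe, hσ]
  have heu : e * u = u := by have := hreg u; rwa [hv, he] at this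
  have hug : u * g = u := by rw [← hg, ← mul_assoc, he, heu]
  have hgv : g * v = v := by have := congrArg σ heu; rwa [map_mul, hσe, hv] at this
  have hve : v * e = v := by have := congrArg σ hug; rwa [map_mul, hσg, hv] at this
  have hege : e * g * e = e := by have := hreg e; rwa [hσe] at this
  have hgeg : g * e * g = g := by have := hreg g; rwa [hσg] at this
  have hee : e * e = e := by rw [← he, mul_assoc, ← mul_assoc v u v, hg, hgv]
  obtain ⟨I, hI⟩ : ∃ I, e * g = I := ⟨_, rfl⟩
  have hgg : g * g = g := by rw [← hσe, ← map_mul, hee]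
  have hIe : ∀ x, e * x = x → I * x = x := by
    intro x hx
    rw [← hx, ← mul_assoc, ← hI, hege]
  have hgI : ∀ x, x * g = x → x * I = x := by
    intro x hx
    rw [← hx, mul_assoc, ← hI, ← mul_assoc g e g, hgeg]
  have heI : e * I = I := by rw [← hI, ← mul_assoc, hee]
  have hIg : I * g = I := by rw [← hI, mul_assoc, hgg]
  have hII : I * I = I := hIe _ heI
  have hIu : I * u = u := hIe _ heu
  have huI : u * I = u := hgI _ hug
  obtain ⟨r, hr⟩ : ∃ r, I * v * I = r := ⟨_, rfl⟩
  have hIr : I * r = r := by rw [← hr, ← mul_assoc, ← mul_assoc, hII]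
  have hrI : r * I = r := by rw [← hr, mul_assoc, hII]
  have hur : u * r = I := by
    rw [← hr, ← mul_assoc, ← mul_assoc, huI, he, heI]
  have hru : r * u = I := by
    rw [← hr, mul_assoc, hIu, mul_assoc, hg, hIg]
  have her : e * r = r := by rw [← hIr, ← mul_assoc, heI]
  have hrg : r * g = r := by rw [← hrI, mul_assoc, hIg]
  have hvIv : v * I * v = v * v := by
    rw [← hI, ← mul_assoc, hve, mul_assoc, hgv]
  have hQ1 : ∀ w c, QQ u v w c → v * I * w * I = v * w * I := by
    intro w c h
    cases h with
    | one => rw [mul_one, mul_one, mul_assoc, hII]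
    | consu w c _ => rw [mul_assoc v I, ← mul_assoc I u, hIu]
    | consv w c _ => rw [← mul_assoc, hvIv, ← mul_assoc]
  have hQz : ∀ w c, QQ u v w c → I * w * I = zz I u r c := by
    intro w c h
    induction h with
    | one => rw [mul_one, hII]; change I = I * u ^ 0; simp
    | consu w c _ ih =>
      rw [← zz_succ hIu huI hII hur hIr, ← ih]
      simp only [← mul_assoc]; rw [hIu, huI]
    | consv w c h ih =>
      rw [← zz_pred hIu hrI hru, ← ih]
      simp only [← mul_assoc]; rw [hrI, ← hr]
      have := hQ1 w c h
      simp only [mul_assoc] at this ⊢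
      rw [this]
  have hzpos : zz I u r ((sct j l).natAbs : ℤ) = u ^ (sct j l).natAbs := by
    obtain ⟨n, hn⟩ : ∃ n, (sct j l).natAbs = n + 1 :=
      ⟨(sct j l).natAbs - 1, by omega⟩
    rw [hn]
    change I * u ^ (n + 1) = _
    rw [pow_succ', ← mul_assoc, hIu]
  have hQu : QQ u v u 1 := by simpa using QQ.consu (u := u) (v := v) 1 0 QQ.one
  have hQv : QQ u v v (-1) := by simpa using QQ.consv (u := u) (v := v) 1 0 QQ.one
  have hQI : QQ u v I 0 := by
    have := (hQu.mul hQv).mul (hQv.mul hQu)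
    rw [he, hg, hI] at this
    simpa using this
  have hQr : QQ u v r (-1) := by
    have := (hQI.mul hQv).mul hQI
    rw [hr] at this
    simpa using this
  -- choose the substituted element with a prescribed sign
  have hchoose : ∀ ε : ℤ, (ε = 1 ∨ ε = -1) → ∃ s, e * s = s ∧ s * g = s ∧
      QQ u v (ap σ (l.map (Function.update (fun _ => (1 : M)) j s)))
        (ε * ((sct j l).natAbs : ℤ)) := by
    intro ε hε
    have hd : ∃ d : ℤ, (d = 1 ∨ d = -1) ∧ d * sct j l = ε * ((sct j l).natAbs : ℤ) := by
      rcases hε with rfl | rfl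
      · rcases lt_or_ge (sct j l) 0 with h | h
        · exact ⟨-1, Or.inr rfl, by omega⟩
        · exact ⟨1, Or.inl rfl, by omega⟩
      · rcases lt_or_ge (sct j l) 0 with h | h
        · exact ⟨1, Or.inl rfl, by omega⟩
        · exact ⟨-1, Or.inr rfl, by omega⟩
    obtain ⟨d, hd1, hd2⟩ := hd
    rw [← hd2]
    subst hv
    rcases hd1 with rfl | rfl
    · exact ⟨u, heu, hug, ap_QQ σ hσ hQu j l⟩
    · exact ⟨r, her, hrg, ap_QQ σ hσ hQr j l⟩
  have hmixed : ∀ w c, w ∈ W → QQ u v w c → e * w = w → w * e = w → I ∈ W := by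
    intro w c hw hq h1 h2
    have h3 : σ w * g = σ w := by rw [← hσe, ← map_mul, h2]
    have hq' : QQ u v (σ w) (-c) := by subst hv; exact hq.bar σ hσ
    have h4 := hQz _ _ (hq.mul hq')
    have h5 : I * (w * σ w) * I = w * σ w := by
      rw [← mul_assoc, hIe w h1, mul_assoc, hgI _ h3]
    rw [h5, add_neg_cancel] at h4
    have h6 : zz I u r 0 = I := by change I * u ^ 0 = I; simp
    rw [h6] at h4
    rw [← h4]
    exact W.mul_mem hw (hW _ hw)
  have hfin : I ∈ W → u ^ (sct j l).natAbs ∈ W := by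
    intro hIW
    obtain ⟨s, _, _, hq⟩ := hchoose 1 (Or.inl rfl)
    rw [← hzpos, ← one_mul ((sct j l).natAbs : ℤ), ← hQz _ _ hq]
    exact W.mul_mem (W.mul_mem hIW (hl s)) hIW
  rcases class_start σ hσ e j l with ⟨h, _⟩ | hs | hs
  · exact absurd h hc0
  · rcases class_end σ hσ g j l with ⟨h, _⟩ | ht | ht
    · exact absurd h hc0
    · obtain ⟨s, h1, h2, hq⟩ := hchoose 1 (Or.inl rfl)
      have := hQz _ _ hq
      rw [one_mul, hzpos, hIe _ (hs s h1), hgI _ (ht s h2)] at this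
      rw [← this]; exact hl s
    · obtain ⟨s, h1, h2, hq⟩ := hchoose 1 (Or.inl rfl)
      rw [hσg] at ht
      exact hfin (hmixed _ _ (hl s) hq (hs s h1) (ht s h2))
  · rw [hσe] at hs
    rcases class_end σ hσ g j l with ⟨h, _⟩ | ht | ht
    · exact absurd h hc0
    · obtain ⟨s, h1, h2, hq⟩ := hchoose 1 (Or.inl rfl)
      have k1 := congrArg σ (hs s h1)
      have k2 := congrArg σ (ht s h2)
      rw [map_mul, hσg] at k1 k2
      have hq' := QQ.bar σ hσ (hv.symm ▸ hq)
      rw [hv] at hq'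
      exact hfin (hmixed _ _ (hW _ (hl s)) hq' k1 k2)
    · rw [hσg] at ht
      obtain ⟨s, h1, h2, hq⟩ := hchoose (-1) (Or.inr rfl)
      have k1 := congrArg σ (hs s h1)
      have k2 := congrArg σ (ht s h2)
      rw [map_mul, hσg] at k1
      rw [map_mul, hσe] at k2
      have hq' := QQ.bar σ hσ (hv.symm ▸ hq)
      rw [hv] at hq'
      have := hQz _ _ hq'
      rw [neg_one_mul, neg_neg, hzpos, hIe _ k1, hgI _ k2] at this
      rw [← this]; exact hW _ (hl s)

end abs

theorem sct_sum {m : ℕ} (l : List (Fin m)) :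
    ∑ j, sct j l = if Even l.length then 0 else 1 := by
  induction l with
  | nil => simp [sct]
  | cons i l ih =>
    simp only [sct, Finset.sum_sub_distrib, ih, List.length_cons, Nat.even_add_one]
    by_cases h : Even l.length <;> simp [h]

/-- The local monoid at `b`. -/
@[ext] structure Loc {A : Type*} (f : A → A → A → A) (b : A) where
  val : A
  prop : f b b val = val ∧ f val b b = val

section loc
variable {A : Type*} {f : A → A → A → A}

@[reducible] def locMonoid (hidem : ∀ a : A, f a a a = a) (hassoc : TAssoc f) (b : A) :
    Monoid (Loc f b) where
  mul y z := ⟨f y.1 b z.1, by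
    rw [← (hassoc _ _ _ _ _).2, ← (hassoc _ _ _ _ _).1, y.2.1], by
    rw [(hassoc _ _ _ _ _).1, (hassoc _ _ _ _ _).2, z.2.2]⟩
  one := ⟨b, hidem b, hidem b⟩
  mul_assoc x y z := Loc.ext (by
    change f (f x.1 b y.1) b z.1 = f x.1 b (f y.1 b z.1)
    rw [(hassoc _ _ _ _ _).1, (hassoc _ _ _ _ _).2])
  one_mul x := Loc.ext x.2.1
  mul_one x := Loc.ext x.2.2

theorem bab_mem (hidem : ∀ a : A, f a a a = a) (hassoc : TAssoc f) (a b : A) :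
    f b b (f b a b) = f b a b ∧ f (f b a b) b b = f b a b := by
  constructor
  · rw [← (hassoc _ _ _ _ _).2, ← (hassoc _ _ _ _ _).1, hidem]
  · rw [(hassoc _ _ _ _ _).1, (hassoc _ _ _ _ _).2, hidem]

def locBar (hidem : ∀ a : A, f a a a = a) (hassoc : TAssoc f) (b : A) :
    letI := locMonoid hidem hassoc b
    Loc f b →* Loc f b :=
  letI := locMonoid hidem hassoc b
  { toFun := fun y => ⟨f b y.1 b, bab_mem hidem hassoc y.1 b⟩
    map_one' := Loc.ext (hidem b)
    map_mul' := fun y z => Loc.ext (by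
      change f b (f y.1 b z.1) b = f (f b y.1 b) b (f b z.1 b)
      rw [(hassoc b y.1 b b _).1, (hassoc b y.1 b b _).2,
        (bab_mem hidem hassoc z.1 b).1, (hassoc b y.1 b z.1 b).2]) }

theorem sandwich (hassoc : TAssoc f) {b : A} (y x z : Loc f b) :
    f (f y.1 b (f b x.1 b)) b z.1 = f y.1 x.1 z.1 := by
  rw [← (hassoc y.1 b b x.1 b).2, ← (hassoc y.1 b b x.1 b).1, y.2.2,
    (hassoc y.1 x.1 b b z.1).1, (hassoc y.1 x.1 b b z.1).2, z.2.1]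

theorem terProd_eq (hidem : ∀ a : A, f a a a = a) (hassoc : TAssoc f) (b : A) :
    letI := locMonoid hidem hassoc b
    ∀ (n : ℕ) (y : Loc f b) (l : List (Loc f b)), l.length = 2 * n →
      terProd f y.1 (l.map Loc.val) = (ap (locBar hidem hassoc b) (y :: l)).1 := by
  letI := locMonoid hidem hassoc b
  intro n
  have hσ : ∀ y, locBar hidem hassoc b (locBar hidem hassoc b y) = y := by
    intro y
    refine Loc.ext ?_
    change f b (f b y.1 b) b = y.1
    rw [← (hassoc _ _ _ _ _).1, y.2.1, y.2.2]
  induction n with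
  | zero =>
    intro y l hl
    obtain rfl : l = [] := List.length_eq_zero_iff.1 (by omega)
    simp [terProd, ap]
  | succ n ih =>
    intro y l hl
    match l, hl with
    | [], hl => simp at hl
    | [_], hl => simp at hl; omega
    | x :: z :: l, hl =>
      simp only [List.length_cons] at hl
      have h := ih (y * locBar hidem hassoc b x * z) l (by omega)
      have h2 : (y * locBar hidem hassoc b x * z).1 = f y.1 x.1 z.1 := sandwich hassoc y x z
      rw [h2] at h
      simp only [List.map_cons, terProd]
      rw [h]
      simp only [ap, map_mul, hσ, mul_assoc]

theorem terProd_pow (hidem : ∀ a : A, f a a a = a) (hassoc : TAssoc f) (a b : A) :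
    letI := locMonoid hidem hassoc b
    ∀ (n : ℕ) (y : Loc f b), terProd f y.1 ((List.replicate n [a, b]).flatten) =
      (y * (⟨f b a b, bab_mem hidem hassoc a b⟩ : Loc f b) ^ n).1 := by
  letI := locMonoid hidem hassoc b
  intro n
  induction n with
  | zero => intro y; simp [terProd]
  | succ n ih =>
    intro y
    have h := ih (y * (⟨f b a b, bab_mem hidem hassoc a b⟩ : Loc f b))
    have h2 : (y * (⟨f b a b, bab_mem hidem hassoc a b⟩ : Loc f b)).1 = f y.1 a b := by
      change f y.1 b (f b a b) = _
      rw [← (hassoc y.1 b b a b).2, ← (hassoc y.1 b b a b).1, y.2.2]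
    rw [h2] at h
    simp only [List.replicate_succ, List.flatten_cons, List.cons_append, List.nil_append, terProd]
    rw [h, pow_succ', mul_assoc]

end loc

/-- Let `(A,f)` be an idempotent ternary semigroup, `B ⊴ A` a
ternary subsemigroup. Then there is a positive integer `l` such that for every
`a ∈ A` and `b ∈ B`, both `b·(a·b)^l ∈ B` and `b·(a·b)^(l+1) ∈ B`. -/
theorem ternary_step7 {A : Type*} (f : A → A → A → A)
    (hidem : ∀ a : A, f a a a = a) (hassoc : TAssoc f)
    (B : Set A) (hne : B.Nonempty)
    (hcl : ∀ x ∈ B, ∀ y ∈ B, ∀ z ∈ B, f x y z ∈ B)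
    (habs : TAbsorbs f B) :
    ∃ l : ℕ, 0 < l ∧ ∀ a : A, ∀ b ∈ B,
      terProd f b ((List.replicate l [a, b]).flatten) ∈ B ∧
      terProd f b ((List.replicate (l + 1) [a, b]).flatten) ∈ B := by
  obtain ⟨m, hd, tl, hev, -, hab⟩ := habs
  have hsum : ∑ j, sct j (hd :: tl) = 1 := by
    rw [sct_sum, if_neg]
    rw [List.length_cons, Nat.even_add_one, not_not]; exact hev
  obtain ⟨N, hN⟩ : ∃ N, ∑ j, (-sct j (hd :: tl)).toNat = N := ⟨_, rfl⟩
  have hP : ∑ j, (sct j (hd :: tl)).toNat = N + 1 := by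
    have : ((∑ j, (sct j (hd :: tl)).toNat : ℕ) : ℤ)
        - ((∑ j, (-sct j (hd :: tl)).toNat : ℕ) : ℤ) = 1 := by
      rw [← hsum]
      push_cast
      rw [← Finset.sum_sub_distrib]
      refine Finset.sum_congr rfl fun j _ => ?_
      omega
    omega
  have main : ∀ a : A, ∀ b ∈ B, ∀ n, (n = N ∨ n = N + 1) →
      letI := locMonoid hidem hassoc b
      ((⟨f b a b, bab_mem hidem hassoc a b⟩ : Loc f b) ^ n).1 ∈ B := by
    intro a b hb n hn
    letI := locMonoid hidem hassoc b
    let W : Submonoid (Loc f b) :=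
      { carrier := {y | y.1 ∈ B}
        one_mem' := hb
        mul_mem' := fun {x y} hx hy => hcl _ hx _ hb _ hy }
    have hσ : ∀ y, locBar hidem hassoc b (locBar hidem hassoc b y) = y := by
      intro y
      refine Loc.ext ?_
      change f b (f b y.1 b) b = y.1
      rw [← (hassoc _ _ _ _ _).1, y.2.1, y.2.2]
    have hreg : ∀ y, y * locBar hidem hassoc b y * y = y := fun y =>
      Loc.ext ((sandwich hassoc y y y).trans (hidem y.1))
    have hW : ∀ y ∈ W, locBar hidem hassoc b y ∈ W := fun y hy => hcl _ hb _ hy _ hb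
    have hk := fun j => key (locBar hidem hassoc b) hσ hreg W hW j (hd :: tl) (by
      intro s
      have h := hab s.1 (fun _ => b) (fun _ => hb) j
      have hup : ∀ i, Function.update (fun _ => b) j s.1 i =
          (Function.update (fun _ => (1 : Loc f b)) j s i).1 := by
        intro i
        by_cases hij : i = j
        · subst hij; simp
        · simp only [Function.update_of_ne hij]; rfl
      have hmap : tl.map (Function.update (fun _ => b) j s.1) =
          (tl.map (Function.update (fun _ => (1 : Loc f b)) j s)).map Loc.val := by
        rw [List.map_map]
        exact List.map_congr_left fun i _ => hup i
      obtain ⟨k, hk⟩ := hev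
      rw [hup, hmap, terProd_eq hidem hassoc b k _ _ (by rw [List.length_map]; omega)] at h
      exact h) ⟨f b a b, bab_mem hidem hassoc a b⟩
    have hS : ∀ g : Fin m → ℕ, (∀ j, g j = 0 ∨ g j = (sct j (hd :: tl)).natAbs) →
        (⟨f b a b, bab_mem hidem hassoc a b⟩ : Loc f b) ^ (∑ j, g j) ∈ W := by
      intro g hg
      refine Finset.sum_induction g
        (fun n => (⟨f b a b, bab_mem hidem hassoc a b⟩ : Loc f b) ^ n ∈ W) ?_ ?_ ?_
      · intro p q hp hq
        rw [pow_add]; exact W.mul_mem hp hq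
      · rw [pow_zero]; exact W.one_mem
      · intro j _
        rcases hg j with h | h
        · simp only [h, pow_zero]; exact W.one_mem
        · rw [h]; exact hk j
    rcases hn with rfl | rfl
    · rw [← hN]; exact hS _ fun j => by omega
    · rw [← hP]; exact hS _ fun j => by omega
  refine ⟨N + (N + 1), by omega, fun a b hb => ?_⟩
  letI := locMonoid hidem hassoc b
  have e1 := fun n => terProd_pow hidem hassoc a b n 1
  have h1 := main a b hb N (Or.inl rfl)
  have h2 := main a b hb (N + 1) (Or.inr rfl)
  constructor
  · refine (e1 _).symm ▸ ?_
    rw [one_mul, pow_add]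
    exact hcl _ h1 _ hb _ h2
  · refine (e1 _).symm ▸ ?_
    rw [one_mul, show N + (N + 1) + 1 = (N + 1) + (N + 1) by ring, pow_add]
    exact hcl _ h2 _ hb _ h2
end

section
/- Let A be an idempotent ternary semigroup, B a ternary subsemigroup of A with B ⊴ A. Then bab ∈ B for every a ∈ A and b ∈ B. -/
namespace TStep

/-- Evaluation of a word in `u`, `σ u`. -/
def ev {M : Type*} [Monoid M] (σ : M →* M) (u : M) (L : List Bool) : M :=
  (L.map fun s => if s then u else σ u).prod

/-- Exponent sum. -/
def expo (L : List Bool) : ℤ := (L.map fun s => if s then (1 : ℤ) else -1).sum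

/-- Normal forms for words starting with `u`. -/
def nf {M : Type*} [Monoid M] (u v : M) (k : ℤ) : Bool → M
  | true => if 1 ≤ k then u ^ k.toNat else u * v ^ (2 - k).toNat * u
  | false => if 0 ≤ k then u ^ (k + 1).toNat * v else u * v ^ (1 - k).toNat

section abs
variable {M : Type*} [Monoid M] (σ : M →* M)

lemma ev_append (u : M) (L L' : List Bool) : ev σ u (L ++ L') = ev σ u L * ev σ u L' := by
  simp [ev]

lemma expo_append (L L' : List Bool) : expo (L ++ L') = expo L + expo L' := by
  simp [expo]

lemma ev_not (h2 : ∀ x, σ (σ x) = x) (u : M) (L : List Bool) :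
    ev σ u L = ev σ (σ u) (L.map not) := by
  induction L with
  | nil => simp [ev]
  | cons a L ih =>
    simp only [ev, List.map_cons, List.prod_cons] at ih ⊢
    rw [ih]; cases a <;> simp [h2]

lemma expo_not (L : List Bool) : expo (L.map not) = - expo L := by
  induction L with
  | nil => simp [expo]
  | cons a L ih =>
    simp only [expo, List.map_cons, List.sum_cons] at ih ⊢
    rw [ih]; cases a <;> simp <;> ring

lemma nf_mul (u v : M) (h1 : u * v * u = u) (h2 : v * u * v = v) (h3 : u * u * v * v = u * v)
    (h4 : v * v * u * u = v * u) (k : ℤ) (s t : Bool) :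
    nf u v k s * (if t then u else v) = nf u v (k + (if t then 1 else -1)) t := by
  cases s <;> cases t
  · -- v, v
    by_cases hk : 1 ≤ k
    · obtain ⟨n, rfl⟩ : ∃ n : ℕ, k = n + 1 := ⟨(k - 1).toNat, by omega⟩
      have e1 : ((n : ℤ) + 1 + 1).toNat = n + 2 := by omega
      have e2 : ((n : ℤ) + 1 + -1 + 1).toNat = n + 1 := by omega
      simp only [nf, Bool.false_eq_true, if_false]
      rw [if_pos (by omega), if_pos (by omega), e1, e2, pow_add, pow_add, pow_two, pow_one]
      simp only [mul_assoc] at h3 ⊢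
      rw [h3]
    · by_cases h0 : k = 0
      · subst h0; simp [nf, pow_two, mul_assoc]
      · simp only [nf, Bool.false_eq_true, if_false]
        rw [if_neg (by omega), if_neg (by omega), mul_assoc, ← pow_succ]
        congr 2; omega
  · -- v, u
    by_cases hk : 0 ≤ k
    · obtain ⟨n, rfl⟩ : ∃ n : ℕ, k = n := ⟨k.toNat, by omega⟩
      have e1 : ((n : ℤ) + 1).toNat = n + 1 := by omega
      simp only [nf, if_true]
      rw [if_pos (by omega), if_pos (by omega), e1, pow_succ]
      simp only [mul_assoc] at h1 ⊢
      rw [h1]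
    · simp only [nf, if_true]
      rw [if_neg (by omega), if_neg (by omega)]
      congr 3; omega
  · -- u, v
    by_cases hk : 1 ≤ k
    · simp only [nf, Bool.false_eq_true, if_false]
      rw [if_pos (by omega), if_pos (by omega)]
      congr 2; omega
    · obtain ⟨n, rfl⟩ : ∃ n : ℕ, k = -n := ⟨(-k).toNat, by omega⟩
      have e1 : (2 - -(n : ℤ)).toNat = n + 1 + 1 := by omega
      have e2 : (1 - (-(n : ℤ) + -1)).toNat = n + 1 + 1 := by omega
      simp only [nf, Bool.false_eq_true, if_false]
      rw [if_neg (by omega), if_neg (by omega), e1, e2, pow_succ _ (n + 1)]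
      simp only [mul_assoc] at h2 ⊢
      rw [h2]
  · -- u, u
    by_cases hk : 1 ≤ k
    · simp only [nf, if_true]
      rw [if_pos (by omega), if_pos (by omega), ← pow_succ]
      congr 1; omega
    · obtain ⟨n, rfl⟩ : ∃ n : ℕ, k = -n := ⟨(-k).toNat, by omega⟩
      have e1 : (2 - -(n : ℤ)).toNat = n + 2 := by omega
      have e2 : (2 - (-(n : ℤ) + 1)).toNat = n + 1 := by omega
      simp only [nf, if_true]
      rw [if_neg (by omega), e1, e2, pow_add, pow_two]
      rcases Nat.eq_zero_or_pos n with rfl | hn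
      · simp only [mul_assoc] at h1 h4 ⊢
        simp [h4, h1]
      · rw [if_neg (by omega), pow_succ]
        simp only [mul_assoc] at h4 ⊢
        rw [h4]

lemma sq_rel (h3 : ∀ x, x * σ x * x = x) (hs : ∀ x, σ (σ x) = x) (u : M) :
    u * u * σ u * σ u = u * σ u := by
  set v := σ u with hv
  have a1 : u * v * u = u := h3 u
  have a2 : v * u * v = v := by have := h3 v; rwa [hv, hs] at this
  have a3 : (v * u) * (u * v) * (v * u) = v * u := by
    have := h3 (v * u); rwa [map_mul, hv, hs] at this
  calc u * u * v * v = (u * v * u) * u * v * (v * u * v) := by rw [a1, a2]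
    _ = u * ((v * u) * (u * v) * (v * u)) * v := by simp only [mul_assoc]
    _ = u * v * (u * v) := by rw [a3]; simp only [mul_assoc]
    _ = u * v := by rw [← mul_assoc, a1]

lemma ev_eq_nf (h3 : ∀ x, x * σ x * x = x) (hs : ∀ x, σ (σ x) = x) (u : M) (L : List Bool) :
    ev σ u (true :: L) = nf u (σ u) (expo (true :: L)) ((true :: L).getLast (by simp)) := by
  induction L using List.reverseRecOn with
  | nil => simp [ev, nf, expo]
  | append_singleton L t ih =>
    have e : true :: (L ++ [t]) = (true :: L) ++ [t] := rfl
    have a2 : σ u * u * σ u = σ u := by have := h3 (σ u); rwa [hs] at this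
    have a4 := sq_rel σ h3 hs (σ u)
    rw [hs] at a4
    simp only [e, ev_append, expo_append, ih, List.getLast_append_singleton]
    have := nf_mul u (σ u) (h3 u) a2 (sq_rel σ h3 hs u) a4 (expo (true :: L))
      ((true :: L).getLast (by simp)) t
    simpa [ev, expo] using this

lemma mem_of_word (h3 : ∀ x, x * σ x * x = x) (hs : ∀ x, σ (σ x) = x) (N : Set M)
    (L : List Bool) (hL : expo L = 1) (hN : ∀ u, ev σ u L ∈ N) (u : M) : u ∈ N := by
  cases L with
  | nil => simp [expo] at hL
  | cons s L =>
    cases s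
    · have key : ∀ u, ev σ u (false :: L) = nf (σ u) u (-1)
          ((true :: L.map not).getLast (by simp)) := by
        intro u
        rw [ev_not σ hs]
        have h := ev_eq_nf σ h3 hs (σ u) (L.map not)
        have h' := expo_not (false :: L)
        simp only [List.map_cons, Bool.not_false] at h' ⊢
        rw [h, h', hL, hs]
      generalize (true :: L.map not).getLast (by simp) = s at key
      have := hN (ev σ u (false :: L))
      rw [key, key] at this
      cases s
      · have h := ev_eq_nf σ h3 hs u [false, false, false, true, true, false, true, true]
        simp [ev, expo, nf] at h
        simp [nf, hs, pow_succ, mul_assoc] at this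
        rwa [h] at this
      · have h := ev_eq_nf σ h3 hs u [false, false, false, true,
          false, true, true, true, false, false, true, true, true, false,
          false, true, true, true, false, true, false, false, false, true]
        simp [ev, expo, nf] at h
        simp [nf, hs, pow_succ, mul_assoc] at this
        rwa [h] at this
    · have key : ∀ u, ev σ u (true :: L) = nf u (σ u) 1
          ((true :: L).getLast (by simp)) := by
        intro u
        rw [ev_eq_nf σ h3 hs, hL]
      generalize (true :: L).getLast (by simp) = s at key
      have := hN (ev σ u (true :: L))
      rw [key, key] at this
      cases s
      · have h := ev_eq_nf σ h3 hs u [true, false, true, true, false, false, false, true]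
        simp [ev, expo, nf] at h
        simp [nf, hs, pow_succ, mul_assoc] at this
        rwa [h] at this
      · simpa [nf] using this

/-- Alternating product. -/
def alt : List M → M
  | [] => 1
  | [_] => 1
  | y :: z :: l => σ y * z * alt l

lemma upd_single {m : ℕ} (t : Bool) (i : Fin m) : ∃ P : Fin m → List Bool,
    (∀ j u, ev σ u (P j) = if t then Function.update (fun _ => (1 : M)) j u i
      else σ (Function.update (fun _ => (1 : M)) j u i)) ∧
    ∑ j, expo (P j) = if t then 1 else -1 := by
  refine ⟨fun j => if j = i then [t] else [], ?_, ?_⟩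
  · intro j u
    by_cases h : j = i
    · subst h; simp [ev]
    · have h' : i ≠ j := fun e => h e.symm
      simp [ev, h, h']
  · have : ∀ j, expo (if j = i then [t] else []) = if j = i then expo [t] else 0 := by
      intro j; split_ifs <;> simp [expo]
    simp [this]
    simp [expo]

lemma alt_words {m : ℕ} (n : ℕ) : ∀ tl : List (Fin m), tl.length = n + n →
    ∃ P : Fin m → List Bool,
    (∀ j u, ev σ u (P j) = alt σ (tl.map (Function.update (fun _ => (1 : M)) j u))) ∧
    ∑ j, expo (P j) = 0 := by
  induction n with
  | zero =>
    intro tl h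
    have : tl = [] := by simpa using h
    subst this
    exact ⟨fun _ => [], by simp [ev, alt], by simp [expo]⟩
  | succ n ih =>
    intro tl h
    match tl, h with
    | [], h => simp at h
    | [_], h => simp at h; omega
    | y :: z :: l, h =>
      obtain ⟨P, hP, hP'⟩ := ih l (by simp at h; omega)
      obtain ⟨Q, hQ, hQ'⟩ := upd_single σ false y
      obtain ⟨R, hR, hR'⟩ := upd_single σ true z
      refine ⟨fun j => Q j ++ R j ++ P j, ?_, ?_⟩
      · intro j u
        simp [ev_append, hP, hQ, hR, alt, mul_assoc]
      · simp [expo_append, Finset.sum_add_distrib, hP', hQ', hR']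

lemma main_abs (h3 : ∀ x, x * σ x * x = x) (hs : ∀ x, σ (σ x) = x) (N : Submonoid M)
    {m : ℕ} (hd : Fin m) (tl : List (Fin m)) (he : Even tl.length)
    (h : ∀ j u, Function.update (fun _ => (1 : M)) j u hd *
      alt σ (tl.map (Function.update (fun _ => (1 : M)) j u)) ∈ N) (u : M) : u ∈ N := by
  obtain ⟨n, hn⟩ := he
  obtain ⟨P, hP, hP'⟩ := alt_words σ n tl hn
  obtain ⟨R, hR, hR'⟩ := upd_single σ true hd
  have hf : ∀ (l : List (Fin m)) u, ev σ u (l.flatMap fun j => R j ++ P j) ∈ N := by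
    intro l u
    induction l with
    | nil => simpa [ev] using N.one_mem
    | cons j l ih =>
      rw [List.flatMap_cons, ev_append]
      refine N.mul_mem ?_ ih
      have := h j u
      simpa [ev_append, hP, hR] using this
  have hx : ∀ l : List (Fin m), expo (l.flatMap fun j => R j ++ P j) =
      (l.map fun j => expo (R j) + expo (P j)).sum := by
    intro l
    induction l with
    | nil => simp [expo]
    | cons j l ih => rw [List.flatMap_cons, expo_append, ih]; simp [expo_append]
  refine mem_of_word σ h3 hs N _ ?_ (hf (List.finRange m)) u
  rw [hx, ← Fin.sum_univ_def, Finset.sum_add_distrib, hP', hR']; simp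

end abs

section conc
variable {A : Type*} {f : A → A → A → A}

lemma as1 (h : TAssoc f) (a b c d e : A) : f (f a b c) d e = f a b (f c d e) :=
  (h a b c d e).1.trans (h a b c d e).2

lemma as2 (h : TAssoc f) (a b c d e : A) : f a (f b c d) e = f a b (f c d e) :=
  (h a b c d e).2

/-- The local monoid at `b`. -/
abbrev Loc (f : A → A → A → A) (b : A) : Type _ := {c : A // f b b c = c ∧ f c b b = c}

/-- The monoid structure. -/
abbrev locMonoid (hidem : ∀ a : A, f a a a = a) (h : TAssoc f) (b : A) :
    Monoid (Loc f b) where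
  mul x y := ⟨f x.1 b y.1, by
    rw [← as1 h, x.2.1], by rw [as1 h, y.2.2]⟩
  one := ⟨b, hidem b, hidem b⟩
  mul_assoc x y z := Subtype.ext (as1 h _ _ _ _ _)
  one_mul x := Subtype.ext x.2.1
  mul_one x := Subtype.ext x.2.2

lemma main_conc (hidem : ∀ a : A, f a a a = a) (h : TAssoc f)
    (B : Set A) (hcl : ∀ x ∈ B, ∀ y ∈ B, ∀ z ∈ B, f x y z ∈ B)
    (habs : TAbsorbs f B) (a b : A) (hb : b ∈ B) : f b a b ∈ B := by
  letI := locMonoid hidem h b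
  have hmul : ∀ x y : Loc f b, (x * y).1 = f x.1 b y.1 := fun _ _ => rfl
  have hone : (1 : Loc f b).1 = b := rfl
  have hbb : ∀ x y z : A, f x b b = x → f x b (f b y z) = f x y z := by
    intro x y z hx
    rw [← as1 h, hx]
  have hp : ∀ x : A, f b b (f b x b) = f b x b ∧ f (f b x b) b b = f b x b := by
    intro x
    refine ⟨by rw [← as1 h, hidem], by rw [as1 h, hidem]⟩
  let σ : Loc f b →* Loc f b :=
    { toFun := fun x => ⟨f b x.1 b, hp x.1⟩
      map_one' := Subtype.ext (hidem b)
      map_mul' := by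
        intro x y
        apply Subtype.ext
        change f b (f x.1 b y.1) b = f (f b x.1 b) b (f b y.1 b)
        rw [hbb _ _ _ (hp x.1).2]
        simp only [as1 h, as2 h] }
  have hσ : ∀ x, (σ x).1 = f b x.1 b := fun _ => rfl
  have hs : ∀ x, σ (σ x) = x := by
    intro x
    apply Subtype.ext
    rw [hσ, hσ, as2 h, x.2.2, x.2.1]
  have htri : ∀ x y z : Loc f b, (x * σ y * z).1 = f x.1 y.1 z.1 := by
    intro x y z
    rw [hmul, hmul, hσ, hbb _ _ _ x.2.2, as1 h, z.2.1]
  have h3 : ∀ x, x * σ x * x = x := by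
    intro x
    apply Subtype.ext
    rw [htri, hidem]
  let N : Submonoid (Loc f b) :=
    { carrier := {x | x.1 ∈ B}
      one_mem' := hb
      mul_mem' := fun {x y} hx hy => hcl _ hx _ hb _ hy }
  have hter : ∀ (n : ℕ) (l : List (Loc f b)) (x : Loc f b), l.length = n + n →
      terProd f x.1 (l.map Subtype.val) = (x * alt σ l).1 := by
    intro n
    induction n with
    | zero =>
      intro l x hl
      have : l = [] := by simpa using hl
      subst this
      simp [terProd, alt]
    | succ n ih =>
      intro l x hl
      match l, hl with
      | [], hl => simp [terProd, alt]
      | [_], hl => simp at hl; omega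
      | y :: z :: l, hl =>
        simp only [List.map_cons, terProd, alt]
        rw [← htri, ih l _ (by simp at hl; omega)]
        simp only [mul_assoc]
  obtain ⟨m, hd, tl, he, -, hab⟩ := habs
  have hfin := main_abs σ h3 hs N hd tl he (by
    intro j u
    have := hab u.1 (fun _ => b) (fun _ => hb) j
    have hu : Function.update (fun _ => b) j u.1 =
        fun i => (Function.update (fun _ => (1 : Loc f b)) j u i).1 := by
      funext i
      by_cases hi : i = j
      · subst hi; simp
      · simp [hi, hone]
    rw [hu] at this
    obtain ⟨n, hn⟩ := he
    have e := hter n (tl.map (Function.update (fun _ => (1 : Loc f b)) j u))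
      (Function.update (fun _ => (1 : Loc f b)) j u hd) (by simpa using hn)
    rw [List.map_map] at e
    change _ ∈ B
    rw [← e]
    exact this) ⟨f b a b, hp a⟩
  exact hfin

end conc

end TStep

/-- Let `(A,f)` be an idempotent ternary semigroup, `B ⊴ A` a
ternary subsemigroup. Then `b·a·b ∈ B` for every `a ∈ A` and `b ∈ B`. -/
theorem ternary_step8 {A : Type*} (f : A → A → A → A)
    (hidem : ∀ a : A, f a a a = a) (hassoc : TAssoc f)
    (B : Set A) (hne : B.Nonempty)
    (hcl : ∀ x ∈ B, ∀ y ∈ B, ∀ z ∈ B, f x y z ∈ B)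
    (habs : TAbsorbs f B) :
    ∀ a : A, ∀ b ∈ B, f b a b ∈ B := by
  exact fun a b hb => TStep.main_conc hidem hassoc B hcl habs a b hb
end

section
/- Let n ≥ 2, let A be an n-ary semigroup and let B be an n-ary subsemigroup of A. Suppose there is an integer k > 1 with k ≡ 1 (mod n−1) such that a^k = a for every a ∈ A, and suppose that b^{k−1}a ∈ B and ab^{k−1} ∈ B for every a ∈ A and b ∈ B. Then b^{n−1}a ∈ B and ab^{n−1} ∈ B for every a ∈ A and b ∈ B. -/
/-- Auxiliary fuelled evaluator: repeatedly replace the first `n` elements of the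
list by their image under the `n`-ary operation `f`, until a single element remains. -/
def naryProdAux {A : Type*} (f : List A → A) (n : ℕ) : ℕ → List A → A
  | 0, l => f l
  | _ + 1, [a] => a
  | fuel + 1, l => naryProdAux f n fuel (f (l.take n) :: l.drop n)

/-- The product of a word `l` in an `n`-ary semigroup (well-behaved when
`l.length ≡ 1 (mod n-1)`). -/
def naryProd {A : Type*} (f : List A → A) (n : ℕ) (l : List A) : A :=
  naryProdAux f n l.length l

/-- `n`-ary associativity: evaluating an inner block of `n` consecutive letters of a
word of length `2n-1` gives the same result no matter where the block is placed. -/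
def NAssoc {A : Type*} (n : ℕ) (f : List A → A) : Prop :=
  ∀ u₁ v₁ w₁ u₂ v₂ w₂ : List A,
    v₁.length = n → v₂.length = n →
    u₁ ++ v₁ ++ w₁ = u₂ ++ v₂ ++ w₂ →
    (u₁ ++ v₁ ++ w₁).length = 2 * n - 1 →
    f (u₁ ++ f v₁ :: w₁) = f (u₂ ++ f v₂ :: w₂)

/-- The word `w` in `m` variables is an idempotent absorbing term for `B` in the
`n`-ary semigroup `(A, f)`. -/
def IsAbsTerm {A : Type*} (n : ℕ) (f : List A → A) (B : Set A) {m : ℕ}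
    (w : List (Fin m)) : Prop :=
  (∀ a : A, naryProd f n (w.map fun _ => a) = a) ∧
  ∀ (a : A) (b : Fin m → A), (∀ i, b i ∈ B) → ∀ j : Fin m,
    naryProd f n (w.map (Function.update b j a)) ∈ B

/-- `B` absorbs the `n`-ary semigroup `(A, f)`. -/
def NAbsorbs {A : Type*} (n : ℕ) (f : List A → A) (B : Set A) : Prop :=
  ∃ (m : ℕ) (w : List (Fin m)), w ≠ [] ∧ w.length % (n - 1) = 1 % (n - 1) ∧
    IsAbsTerm n f B w


theorem aux_fuel {A : Type*} (f : List A → A) (n : ℕ) (hn : 2 ≤ n) :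
    ∀ (p q : ℕ) (l : List A), l ≠ [] → l.length ≤ p → l.length ≤ q →
      naryProdAux f n p l = naryProdAux f n q l := by
  intro p
  induction p with
  | zero => intro q l h1 h2; exact absurd (List.length_eq_zero_iff.mp (by omega)) h1
  | succ p ih =>
    intro q l h1 h2 h3
    cases q with
    | zero => exact absurd (List.length_eq_zero_iff.mp (by omega)) h1
    | succ q =>
      match l, h1 with
      | [a], _ => simp [naryProdAux]
      | a :: b :: t, _ =>
        simp only [naryProdAux]
        apply ih
        · simp
        · simp only [List.length_cons, List.length_drop] at *; omega
        · simp only [List.length_cons, List.length_drop] at *; omega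

theorem prod_single {A : Type*} (f : List A → A) (n : ℕ) (a : A) :
    naryProd f n [a] = a := by simp [naryProd, naryProdAux]

theorem prod_step {A : Type*} (f : List A → A) (n : ℕ) (hn : 2 ≤ n) (v d : List A)
    (hv : v.length = n) : naryProd f n (v ++ d) = naryProd f n (f v :: d) := by
  match v, hv with
  | [], hv => simp at hv; omega
  | [a], hv => simp at hv; omega
  | a :: b :: t, hv =>
    have h1 : naryProd f n (a :: b :: t ++ d) = naryProdAux f n (t ++ d).length.succ
        (f ((a :: b :: t ++ d).take n) :: (a :: b :: t ++ d).drop n) := by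
      simp only [naryProd, List.cons_append, List.length_cons, naryProdAux]
    rw [h1, ← hv, List.take_left, List.drop_left, hv]
    apply aux_fuel f n hn
    · simp
    · simp
    · simp

theorem prod_n {A : Type*} (f : List A → A) (n : ℕ) (hn : 2 ≤ n) (v : List A)
    (hv : v.length = n) : naryProd f n v = f v := by
  have := prod_step f n hn v [] hv
  rwa [List.append_nil, prod_single] at this

theorem prod_inner {A : Type*} (f : List A → A) (n : ℕ) (hn : 2 ≤ n) (hassoc : NAssoc n f) :
    ∀ (N : ℕ) (u v d : List A), u.length ≤ N → v.length = n → (n - 1) ∣ (u.length + d.length) →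
      naryProd f n (u ++ v ++ d) = naryProd f n (u ++ f v :: d) := by
  intro N
  induction N with
  | zero =>
    intro u v d hu hv hd
    have : u = [] := List.length_eq_zero_iff.mp (by omega)
    subst this
    simpa using prod_step f n hn v d hv
  | succ N ih =>
    intro u v d hu hv hd
    by_cases h0 : u.length = 0
    · exact ih u v d (by omega) hv hd
    by_cases h1 : n ≤ u.length
    · obtain ⟨x, y, rfl, hx⟩ : ∃ x y, u = x ++ y ∧ x.length = n :=
        ⟨u.take n, u.drop n, by simp, by simp; omega⟩
      simp only [List.length_append] at *
      have e1 := prod_step f n hn x (y ++ v ++ d) hx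
      have e2 := prod_step f n hn x (y ++ f v :: d) hx
      have e3 := ih (f x :: y) v d (by simp; omega) hv (by
        obtain ⟨c, hc⟩ := hd
        refine (Nat.dvd_add_right (dvd_refl (n-1))).mp ?_
        refine ⟨c, ?_⟩
        rw [← hc]; simp; omega)
      simp only [List.append_assoc, List.cons_append] at *
      rw [e1, e2, e3]
    · have hle : n - 1 ≤ u.length + d.length := Nat.le_of_dvd (by omega) hd
      obtain ⟨x, y, rfl, hx⟩ : ∃ x y, d = x ++ y ∧ x.length = n - 1 - u.length :=
        ⟨d.take (n - 1 - u.length), d.drop (n - 1 - u.length), by simp, by simp; omega⟩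
      have e1 := prod_step f n hn (u ++ f v :: x) y (by simp; omega)
      have hlen : (u ++ v ++ x).length = 2 * n - 1 := by simp; omega
      obtain ⟨p, q, hpq, hp⟩ : ∃ p q, u ++ v ++ x = p ++ q ∧ p.length = n :=
        ⟨(u ++ v ++ x).take n, (u ++ v ++ x).drop n, (List.take_append_drop _ _).symm, by
          rw [List.length_take]; omega⟩
      have hq : q.length = n - 1 := by
        rw [hpq, List.length_append] at hlen; omega
      have e2 := prod_step f n hn p (q ++ y) hp
      have e3 := prod_step f n hn (f p :: q) y (by simp; omega)
      have e4 := hassoc u v x [] p q hv hp (by simpa using hpq) hlen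
      have e5 : u ++ v ++ (x ++ y) = p ++ (q ++ y) := by
        rw [← List.append_assoc, hpq, List.append_assoc]
      rw [e5, e2]
      simp only [List.append_assoc, List.cons_append, List.nil_append] at *
      rw [e3, e1, e4]

theorem prod_nest {A : Type*} (f : List A → A) (n : ℕ) (hn : 2 ≤ n) (hassoc : NAssoc n f) :
    ∀ (m : ℕ) (u l w : List A), l.length = 1 + m * (n - 1) → u.length + w.length = n - 1 →
      f (u ++ naryProd f n l :: w) = naryProd f n (u ++ l ++ w) := by
  intro m
  induction m with
  | zero =>
    intro u l w hl hu
    obtain ⟨a, rfl⟩ := List.length_eq_one_iff.mp (by simpa using hl)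
    rw [prod_single, prod_n f n hn _ (by simp; omega)]
    simp
  | succ m ih =>
    intro u l w hl hu
    rw [Nat.add_mul] at hl
    obtain ⟨x, y, rfl, hx⟩ : ∃ x y, l = x ++ y ∧ x.length = n :=
      ⟨l.take n, l.drop n, by simp, by simp; omega⟩
    simp only [List.length_append] at hl
    rw [prod_step f n hn x y hx, ih u (f x :: y) w (by simp; omega) hu]
    have := prod_inner f n hn hassoc u.length u x (y ++ w) le_rfl hx
      ⟨m + 1, by rw [List.length_append, Nat.mul_comm, Nat.add_mul]; omega⟩
    simp only [List.append_assoc, List.cons_append] at *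
    rw [this]

/-- Let `(A,f)` be an `n`-ary semigroup, `B` an `n`-ary subsemigroup.
Suppose there is `k > 1` with `k ≡ 1 (mod n-1)` such that `a^k = a` for all `a ∈ A`,
and suppose `b^(k-1)·a ∈ B` and `a·b^(k-1) ∈ B` for all `a ∈ A`, `b ∈ B`.
Then `b^(n-1)·a ∈ B` and `a·b^(n-1) ∈ B` for all `a ∈ A`, `b ∈ B`. -/
theorem nary_power_absorption_reduction {A : Type*} (n : ℕ) (hn : 2 ≤ n)
    (f : List A → A) (hassoc : NAssoc n f)
    (B : Set A) (hne : B.Nonempty)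
    (hcl : ∀ l : List A, l.length = n → (∀ x ∈ l, x ∈ B) → f l ∈ B)
    (k : ℕ) (hk : 1 < k) (hkd : (n - 1) ∣ (k - 1))
    (hpow : ∀ a : A, naryProd f n (List.replicate k a) = a)
    (h : ∀ a : A, ∀ b ∈ B,
      naryProd f n (List.replicate (k - 1) b ++ [a]) ∈ B ∧
      naryProd f n (a :: List.replicate (k - 1) b) ∈ B) :
    ∀ a : A, ∀ b ∈ B,
      naryProd f n (List.replicate (n - 1) b ++ [a]) ∈ B ∧
      naryProd f n (a :: List.replicate (n - 1) b) ∈ B := by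
  intro a b hb
  obtain ⟨m, hm⟩ := hkd
  rw [Nat.mul_comm] at hm
  have hR : ∀ p q r : ℕ, p + q = r →
      List.replicate p b ++ List.replicate q b = List.replicate r b := by
    intro p q r e; rw [← e, List.replicate_add]
  obtain ⟨h1, h2⟩ := h a b hb
  constructor
  · have e1 := prod_nest f n hn hassoc m (List.replicate (n - 1) b)
      (List.replicate (k - 1) b ++ [a]) [] (by simp; omega) (by simp)
    have e2 := prod_nest f n hn hassoc m [] (List.replicate k b)
      (List.replicate (n - 2) b ++ [a]) (by simp; omega) (by simp; omega)
    have c := hcl (List.replicate (n - 1) b ++ [naryProd f n (List.replicate (k - 1) b ++ [a])])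
      (by simp; omega) (by
        intro x hx
        simp only [List.mem_append, List.mem_replicate, List.mem_singleton] at hx
        rcases hx with hx | hx
        · rw [hx.2]; exact hb
        · rw [hx]; exact h1)
    rw [e1, List.append_nil, ← List.append_assoc, hR _ _ (k + (n - 2)) (by omega)] at c
    rw [hpow, List.nil_append, List.nil_append, ← List.append_assoc, hR _ _ _ rfl] at e2
    rw [← e2, ← List.cons_append, ← List.replicate_succ, show n - 2 + 1 = n - 1 by omega] at c
    rwa [prod_n f n hn _ (by simp; omega)]
  · have e1 := prod_nest f n hn hassoc m [] (a :: List.replicate (k - 1) b)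
      (List.replicate (n - 1) b) (by simp; omega) (by simp)
    have e2 := prod_nest f n hn hassoc m [a] (List.replicate k b)
      (List.replicate (n - 2) b) (by simp; omega) (by simp; omega)
    have c := hcl (naryProd f n (a :: List.replicate (k - 1) b) :: List.replicate (n - 1) b)
      (by simp; omega) (by
        intro x hx
        simp only [List.mem_cons, List.mem_replicate] at hx
        rcases hx with hx | hx
        · rw [hx]; exact h2
        · rw [hx.2]; exact hb)
    rw [List.nil_append, List.nil_append, List.cons_append,
      hR _ _ (k + (n - 2)) (by omega)] at e1
    rw [hpow, List.append_assoc, hR _ _ _ rfl, ← List.replicate_succ,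
      show n - 2 + 1 = n - 1 by omega] at e2
    rw [e1] at c
    rw [prod_n f n hn _ (by simp; omega)]
    simp only [List.cons_append, List.nil_append] at e2
    rwa [e2]
end
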